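/- arXiv:1705.04338 — 11 statements merged into one kernel-verified Lean document; each statement's English description precedes it below -/
import Mathlib

section
/- Let n ≥ 3 be an integer and let k be a positive divisor of n with k ≠ n and n/k ≥ 2. Then there are infinitely many tuples (x₁, …, x_n, y₁, …, y_{n/k}) of nonzero integers that simultaneously satisfy x₁ + x₂ + ⋯ + x_n = k·(y₁ + y₂ + ⋯ + y_{n/k}) and x₁³ + x₂³ + ⋯ + x_n³ = k·(y₁³ + y₂³ + ⋯ + y_{n/k}³), and that are nontrivial in the sense that xᵢ ≠ ±x_j for all i ≠ j, yᵢ ≠ ±y_j for all i ≠ j, and xᵢ ≠ ±y_j for all i, j. -/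
/-- Integers of any prescribed sum `s`, pairwise distinct and all different from `0` and `s`. -/
lemma exists_injective_sum_eq (k : ℕ) (hk : 2 ≤ k) (s : ℤ) :
    ∃ u : Fin k → ℤ, Function.Injective u ∧ (∀ i, u i ≠ 0) ∧ (∀ i, u i ≠ s) ∧ ∑ i, u i = s := by
  obtain ⟨r, rfl⟩ : ∃ r, k = r + 2 := ⟨k - 2, by omega⟩
  set v : Fin (r + 1) → ℤ := fun i => |s| + 1 + (i : ℕ) with hv
  have hs := le_abs_self s
  have hs0 := abs_nonneg s
  have hpos : ∀ i, |s| + 1 ≤ v i := fun i => by simp [hv]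
  have hsum : |s| + 1 ≤ ∑ i, v i :=
    (hpos 0).trans (Finset.single_le_sum (f := v) (fun i _ => by linarith [hpos i])
      (Finset.mem_univ 0))
  refine ⟨Fin.cons (s - ∑ i, v i) v, ?_, ?_, ?_, ?_⟩
  · rw [Fin.cons_injective_iff]
    refine ⟨?_, fun i j h => ?_⟩
    · rintro ⟨i, hi⟩
      linarith [hpos i]
    · simp only [hv] at h
      exact Fin.ext (by omega)
  · intro i
    refine Fin.cases ?_ (fun j => ?_) i
    · simp only [Fin.cons_zero]
      linarith
    · simp only [Fin.cons_succ]
      linarith [hpos j]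
  · intro i
    refine Fin.cases ?_ (fun j => ?_) i
    · simp only [Fin.cons_zero]
      linarith
    · simp only [Fin.cons_succ]
      linarith [hpos j]
  · simp [Fin.sum_univ_succ (n := r + 1)]

/-- The line through the all-ones solution: given `∑ f = k ∑ g`, it meets the cubic again in the
point displayed here. -/
lemma sum_cube_eq_of_sum_eq {α β : Type*} [Fintype α] [Fintype β] (k q R : ℤ)
    (f : α → ℤ) (g : β → ℤ) (hcard : (Fintype.card α : ℤ) = k * Fintype.card β)
    (h₁ : ∑ a, f a = k * ∑ b, g b) (h₂ : ∑ a, f a ^ 2 = k * ∑ b, g b ^ 2 + q)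
    (h₃ : ∑ a, f a ^ 3 = k * ∑ b, g b ^ 3 + R) :
    ∑ a, (R - 3 * q * f a) = k * ∑ b, (R - 3 * q * g b) ∧
      ∑ a, (R - 3 * q * f a) ^ 3 = k * ∑ b, (R - 3 * q * g b) ^ 3 := by
  have cube : ∀ z : ℤ, (R - 3 * q * z) ^ 3 =
      R ^ 3 - 9 * R ^ 2 * q * z + 27 * R * q ^ 2 * z ^ 2 - 27 * q ^ 3 * z ^ 3 := fun z => by ring
  simp only [cube, Finset.sum_add_distrib, Finset.sum_sub_distrib, ← Finset.mul_sum,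
    Finset.sum_const, Finset.card_univ, nsmul_eq_mul, h₁, h₂, h₃, hcard]
  constructor <;> ring

/-- Scaling a positive solution with distinct entries gives infinitely many nontrivial ones. -/
lemma infinite_of_pos_solution (n m k : ℕ) (hm : 0 < m) (hn : n = m * k)
    (X : Fin m × Fin k → ℤ) (Y : Fin m → ℤ)
    (hX : ∀ a, 0 < X a) (hY : ∀ j, 0 < Y j) (hXi : Function.Injective X)
    (hYi : Function.Injective Y) (hXY : ∀ a j, X a ≠ Y j)
    (h₁ : ∑ a, X a = (k : ℤ) * ∑ j, Y j) (h₃ : ∑ a, X a ^ 3 = (k : ℤ) * ∑ j, Y j ^ 3) :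
    {p : (Fin n → ℤ) × (Fin m → ℤ) |
      (∀ i, p.1 i ≠ 0) ∧ (∀ j, p.2 j ≠ 0) ∧
      (∑ i, p.1 i) = (k : ℤ) * (∑ j, p.2 j) ∧
      (∑ i, (p.1 i) ^ 3) = (k : ℤ) * (∑ j, (p.2 j) ^ 3) ∧
      (∀ i j, i ≠ j → p.1 i ≠ p.1 j ∧ p.1 i ≠ -(p.1 j)) ∧
      (∀ i j, i ≠ j → p.2 i ≠ p.2 j ∧ p.2 i ≠ -(p.2 j)) ∧
      (∀ i j, p.1 i ≠ p.2 j ∧ p.1 i ≠ -(p.2 j))}.Infinite := by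
  subst hn
  set e : Fin (m * k) ≃ Fin m × Fin k := finProdFinEquiv.symm
  refine Set.infinite_of_injective_forall_mem
    (f := fun t : ℕ => ((fun i => ((t : ℤ) + 1) * X (e i), fun j => ((t : ℤ) + 1) * Y j) :
      (Fin (m * k) → ℤ) × (Fin m → ℤ))) ?_ ?_
  · intro s t hst
    have h := congrFun (Prod.ext_iff.1 hst).2 ⟨0, hm⟩
    have h' := mul_right_cancel₀ (hY _).ne' h
    exact_mod_cast add_right_cancel h'
  · intro t
    have ht : (0 : ℤ) < (t : ℤ) + 1 := by positivity
    have hX' : ∀ a, 0 < ((t : ℤ) + 1) * X a := fun a => mul_pos ht (hX a)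
    have hY' : ∀ a, 0 < ((t : ℤ) + 1) * Y a := fun a => mul_pos ht (hY a)
    refine ⟨fun i => (hX' _).ne', fun j => (hY' j).ne', ?_, ?_, fun i j hij => ⟨fun h => ?_, ?_⟩,
      fun i j hij => ⟨fun h => ?_, ?_⟩, fun i j => ⟨fun h => ?_, ?_⟩⟩
    · simp only [← Finset.mul_sum]
      rw [e.sum_comp X, h₁]
      ring
    · simp only [mul_pow, ← Finset.mul_sum]
      rw [e.sum_comp (fun a => X a ^ 3), h₃]
      ring
    · exact hij (e.injective (hXi (mul_left_cancel₀ ht.ne' h)))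
    · exact (by linarith [hX' (e i), hX' (e j)] : _ < _).ne'
    · exact hij (hYi (mul_left_cancel₀ ht.ne' h))
    · exact (by linarith [hY' i, hY' j] : _ < _).ne'
    · exact hXY _ _ (mul_left_cancel₀ ht.ne' h)
    · exact (by linarith [hX' (e i), hY' j] : _ < _).ne'

/-- Two values `y = c ± v`, with the `x` in pairs `c ± w i` where `∑ w i ^ 2 = k * v ^ 2`. -/
lemma exists_pos_solution_two (k : ℕ) (hk : 2 ≤ k) :
    ∃ (X : Fin 2 × Fin k → ℤ) (Y : Fin 2 → ℤ),
      (∀ a, 0 < X a) ∧ (∀ j, 0 < Y j) ∧ Function.Injective X ∧ Function.Injective Y ∧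
      (∀ a j, X a ≠ Y j) ∧ ∑ a, X a = (k : ℤ) * ∑ j, Y j ∧
      ∑ a, X a ^ 3 = (k : ℤ) * ∑ j, Y j ^ 3 := by
  obtain ⟨u, hu, hu0, hu1, hus⟩ := exists_injective_sum_eq k hk 1
  set Q := ∑ i, u i ^ 2 with hQ
  have hQu : ∀ i, u i ^ 2 < Q := by
    intro i
    have : Nontrivial (Fin k) := Fin.nontrivial_iff_two_le.2 hk
    obtain ⟨j, hj⟩ := exists_ne i
    exact Finset.single_lt_sum hj (Finset.mem_univ i) (Finset.mem_univ j)
      (by have := hu0 j; positivity) (fun l _ _ => sq_nonneg _)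
  have hQ0 : 0 < Q := (sq_nonneg _).trans_lt (hQu ⟨0, by omega⟩)
  set w : Fin k → ℤ := fun i => Q - 2 * u i with hw
  have hw0 : ∀ i, 0 < w i := by
    intro i
    have h1 : 2 * u i ≤ u i ^ 2 := by
      rcases lt_or_gt_of_ne (hu1 i) with h | h
      · nlinarith
      · nlinarith
    simp only [hw]
    linarith [hQu i]
  have hw4 : ∀ i, w i < 4 * Q := by
    intro i
    simp only [hw]
    nlinarith [hQu i, sq_nonneg (u i + 1)]
  have hwi : ∀ i j, w i = w j → i = j := fun i j h => hu (by simp only [hw] at h; linarith)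
  have hwQ : ∀ i, w i ≠ Q := fun i h => hu0 i (by simp only [hw] at h; linarith)
  have hw2 : ∑ i, w i ^ 2 = k * Q ^ 2 := by
    have : ∀ i, w i ^ 2 = Q ^ 2 - 4 * Q * u i + 4 * u i ^ 2 := fun i => by simp only [hw]; ring
    simp only [this, Finset.sum_add_distrib, Finset.sum_sub_distrib, ← Finset.mul_sum, hus,
      Finset.sum_const, Finset.card_univ, Fintype.card_fin, nsmul_eq_mul, ← hQ]
    ring
  refine ⟨fun a => 4 * Q + ![1, -1] a.1 * w a.2, fun j => 4 * Q + ![1, -1] j * Q,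
    ?_, ?_, ?_, ?_, ?_, ?_, ?_⟩
  · rintro ⟨j, i⟩
    have := hw0 i
    have := hw4 i
    fin_cases j <;> simp <;> linarith
  · intro j
    fin_cases j <;> simp <;> linarith
  · rintro ⟨j, i⟩ ⟨j', i'⟩ h
    have := hw0 i
    have := hw0 i'
    fin_cases j <;> fin_cases j' <;> simp at h ⊢
    · exact hwi _ _ h
    · linarith
    · linarith
    · exact hwi _ _ h
  · intro j j' h
    fin_cases j <;> fin_cases j' <;> simp at h ⊢ <;> linarith
  · rintro ⟨j, i⟩ j' h
    have := hw0 i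
    have := hwQ i
    fin_cases j <;> fin_cases j' <;> simp at h <;> first | contradiction | linarith
  · simp only [Fintype.sum_prod_type, Fin.sum_univ_two, ← Finset.sum_add_distrib]
    have : ∀ i, (4 * Q + ![1, -1] (0 : Fin 2) * w i) + (4 * Q + ![1, -1] (1 : Fin 2) * w i)
        = 8 * Q := fun i => by simp; ring
    simp only [this, Finset.sum_const, Finset.card_univ, Fintype.card_fin, nsmul_eq_mul]
    simp
    exact Or.inl (by ring)
  · simp only [Fintype.sum_prod_type, Fin.sum_univ_two, ← Finset.sum_add_distrib]
    have : ∀ i, (4 * Q + ![1, -1] (0 : Fin 2) * w i) ^ 3 + (4 * Q + ![1, -1] (1 : Fin 2) * w i) ^ 3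
        = 128 * Q ^ 3 + 24 * Q * w i ^ 2 := fun i => by simp; ring
    simp only [this, Finset.sum_add_distrib, ← Finset.mul_sum, hw2, Finset.sum_const,
      Finset.card_univ, Fintype.card_fin, nsmul_eq_mul]
    simp
    ring

/-- An integer bounding finitely many integers in absolute value. -/
lemma exists_abs_le {α : Type*} [Finite α] (f : α → ℤ) : ∃ B : ℤ, ∀ a, |f a| ≤ B := by
  obtain ⟨B, hB⟩ := (Set.finite_range fun a => |f a|).bddAbove
  exact ⟨B, fun a => hB ⟨a, rfl⟩⟩

/-- Perturbing `k` copies of `M * e j` by `c j * h i`, where the first moments of `c` against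
`1` and `e` vanish but the second does not, pushes the point of `sum_cube_eq_of_sum_eq` far out
as `M` grows. -/
lemma exists_pos_solution_of_moments (m k : ℕ) (hm : 0 < m) (hk : 0 < k)
    (e c : Fin m → ℤ) (h : Fin k → ℤ)
    (he : Function.Injective e) (hh : Function.Injective h) (hc0 : ∀ j, c j ≠ 0)
    (hh0 : ∀ i, h i ≠ 0) (hs : ∑ i, h i = 1) (hc : ∑ j, c j = 0) (hec : ∑ j, e j * c j = 0)
    (hecc : ∑ j, e j * c j ^ 2 = 0) (heec : 0 < ∑ j, e j ^ 2 * c j) :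
    ∃ (X : Fin m × Fin k → ℤ) (Y : Fin m → ℤ),
      (∀ a, 0 < X a) ∧ (∀ j, 0 < Y j) ∧ Function.Injective X ∧ Function.Injective Y ∧
      (∀ a j, X a ≠ Y j) ∧ ∑ a, X a = (k : ℤ) * ∑ j, Y j ∧
      ∑ a, X a ^ 3 = (k : ℤ) * ∑ j, Y j ^ 3 := by
  set A := ∑ j, e j ^ 2 * c j with hA
  set q := (∑ j, c j ^ 2) * ∑ i, h i ^ 2 with hq
  set T := (∑ j, c j ^ 3) * ∑ i, h i ^ 3 with hT
  have hq0 : 0 < q := by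
    refine mul_pos (Finset.sum_pos (fun j _ => ?_) ⟨⟨0, hm⟩, Finset.mem_univ _⟩)
      (Finset.sum_pos (fun i _ => ?_) ⟨⟨0, hk⟩, Finset.mem_univ _⟩)
    · have := hc0 j; positivity
    · have := hh0 i; positivity
  obtain ⟨B₁, hB₁⟩ := exists_abs_le e
  obtain ⟨B₂, hB₂⟩ := exists_abs_le fun a : Fin m × Fin k => c a.1 * h a.2
  obtain ⟨B, hBe, hBch, hBT, hBq⟩ : ∃ B : ℤ, (∀ j, |e j| ≤ B) ∧ (∀ j i, |c j * h i| ≤ B) ∧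
      |T| ≤ B ∧ q ≤ B := by
    refine ⟨max (max B₁ B₂) (max |T| q), fun j => ?_, fun j i => ?_, ?_, ?_⟩
    · exact (hB₁ j).trans (by simp)
    · exact (hB₂ (j, i)).trans (by simp)
    · simp
    · simp
  have hB1 : 1 ≤ B := by linarith
  set M := 4 * B ^ 2 with hM
  have hMB : 2 * B < M := by nlinarith
  have hM0 : 0 < M := by linarith
  set R := 3 * M ^ 2 * A + T with hR
  have sep : ∀ j j' (x y : ℤ), |x| ≤ B → |y| ≤ B → M * e j + x = M * e j' + y → j = j' := by
    intro j j' x y hx hy hxy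
    apply he
    rw [abs_le] at hx hy
    by_contra hne
    rcases lt_or_gt_of_ne hne with hlt | hlt
    · nlinarith
    · nlinarith
  have pos : ∀ j x, |x| ≤ B → 0 < R - 3 * q * (M * e j + x) := by
    intro j x hx
    have h1 : M * e j + x ≤ M * B + B := by
      have := mul_le_mul_of_nonneg_left ((le_abs_self _).trans (hBe j)) hM0.le
      linarith [(le_abs_self _).trans hx]
    have h2 : q * (M * e j + x) ≤ B * (M * B + B) :=
      (mul_le_mul_of_nonneg_left h1 hq0.le).trans
        (mul_le_mul_of_nonneg_right hBq (by positivity))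
    have h3 : 3 * M ^ 2 ≤ 3 * M ^ 2 * A := le_mul_of_one_le_right (by positivity) heec
    have h4 : -B ≤ T := (abs_le.1 hBT).1
    have h5 : B * (M * B + B) = 4 * B ^ 4 + B ^ 2 := by rw [hM]; ring
    have h6 : M ^ 2 = 16 * B ^ 4 := by rw [hM]; ring
    have h7 : B ≤ B ^ 2 := by nlinarith
    have h8 : B ^ 2 ≤ B ^ 4 := by nlinarith [sq_nonneg B]
    rw [hR]
    nlinarith
  have hB0 : |(0 : ℤ)| ≤ B := by simpa using by linarith
  have h3q : 3 * q ≠ 0 := by positivity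
  obtain ⟨hlin, hcube⟩ := sum_cube_eq_of_sum_eq (k : ℤ) q R
    (fun a : Fin m × Fin k => M * e a.1 + c a.1 * h a.2) (fun j => M * e j + 0)
    (by simp [mul_comm])
    (by
      simp only [Fintype.sum_prod_type, Finset.sum_add_distrib, ← Finset.mul_sum, hs,
        Finset.sum_const, Finset.card_univ, Fintype.card_fin, nsmul_eq_mul, mul_one, hc]
      ring)
    (by
      have : ∀ j i, (M * e j + c j * h i) ^ 2 =
        M ^ 2 * e j ^ 2 + 2 * M * (e j * c j) * h i + c j ^ 2 * h i ^ 2 := fun j i => by ring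
      simp only [Fintype.sum_prod_type, this, Finset.sum_add_distrib, ← Finset.mul_sum, hs,
        Finset.sum_const, Finset.card_univ, Fintype.card_fin, nsmul_eq_mul, mul_one,
        ← Finset.sum_mul, hec, add_zero, mul_pow, ← hq]
      ring)
    (by
      have : ∀ j i, (M * e j + c j * h i) ^ 3 = M ^ 3 * e j ^ 3 + 3 * M ^ 2 * (e j ^ 2 * c j) * h i
        + 3 * M * (e j * c j ^ 2) * h i ^ 2 + c j ^ 3 * h i ^ 3 := fun j i => by ring
      simp only [Fintype.sum_prod_type, this, Finset.sum_add_distrib, ← Finset.mul_sum, hs,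
        Finset.sum_const, Finset.card_univ, Fintype.card_fin, nsmul_eq_mul, mul_one,
        ← Finset.sum_mul, hecc, add_zero, mul_pow, ← hT, ← hA, hR]
      ring)
  have cancel : ∀ x y : ℤ, R - 3 * q * x = R - 3 * q * y → x = y := fun x y hxy =>
    mul_left_cancel₀ h3q (by linarith)
  refine ⟨_, _, fun a => pos _ _ (hBch _ _), fun j => pos _ _ hB0, ?_, ?_, ?_, hlin, hcube⟩
  · rintro ⟨j, i⟩ ⟨j', i'⟩ hji
    have hji := cancel _ _ hji
    obtain rfl := sep _ _ _ _ (hBch _ _) (hBch _ _) hji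
    exact Prod.ext rfl (hh (mul_left_cancel₀ (hc0 j) (add_left_cancel hji)))
  · intro j j' hjj
    exact sep _ _ _ _ hB0 hB0 (cancel _ _ hjj)
  · rintro ⟨j, i⟩ j' hjj
    have hjj := cancel _ _ hjj
    obtain rfl := sep _ _ _ _ (hBch _ _) hB0 hjj
    exact mul_ne_zero (hc0 j) (hh0 i) (add_left_cancel hjj)

lemma exists_pos_solution_of_three_le (m k : ℕ) (hm : 3 ≤ m) (hk : 0 < k) :
    ∃ (X : Fin m × Fin k → ℤ) (Y : Fin m → ℤ),
      (∀ a, 0 < X a) ∧ (∀ j, 0 < Y j) ∧ Function.Injective X ∧ Function.Injective Y ∧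
      (∀ a j, X a ≠ Y j) ∧ ∑ a, X a = (k : ℤ) * ∑ j, Y j ∧
      ∑ a, X a ^ 3 = (k : ℤ) * ∑ j, Y j ^ 3 := by
  obtain ⟨h, hh, hh0, hs⟩ : ∃ h : Fin k → ℤ, Function.Injective h ∧ (∀ i, h i ≠ 0) ∧
      ∑ i, h i = 1 := by
    obtain rfl | hk2 : k = 1 ∨ 2 ≤ k := by omega
    · exact ⟨fun _ => 1, Function.injective_of_subsingleton _, by simp, by simp⟩
    · obtain ⟨u, hu, hu0, -, hus⟩ := exists_injective_sum_eq k hk2 1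
      exact ⟨u, hu, hu0, hus⟩
  obtain ⟨r, rfl⟩ : ∃ r, m = r + 1 := ⟨m - 1, by omega⟩
  obtain ⟨a, ha, ha0, -, has⟩ := exists_injective_sum_eq r (by omega) 0
  refine exists_pos_solution_of_moments (r + 1) k (by omega) hk (Fin.cons 0 a)
    (Fin.cons (-(r : ℤ)) fun _ => 1) h ?_ hh ?_ hh0 hs ?_ ?_ ?_ ?_
  · rw [Fin.cons_injective_iff]
    exact ⟨fun ⟨i, hi⟩ => ha0 i hi, ha⟩
  · intro j
    refine Fin.cases ?_ (fun i => ?_) j <;> simp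
    omega
  · simp [Fin.sum_univ_succ]
  · simp [Fin.sum_univ_succ, has]
  · simp [Fin.sum_univ_succ, has]
  · simp only [Fin.sum_univ_succ, Fin.cons_zero, Fin.cons_succ]
    have : 0 < ∑ i, a i ^ 2 :=
      Finset.sum_pos (fun i _ => by have := ha0 i; positivity)
        ⟨⟨0, by omega⟩, Finset.mem_univ _⟩
    simpa using this


/-- For `n ≥ 3` and `k` a positive divisor of `n` with `k ≠ n` and `n/k ≥ 2`,
there are infinitely many tuples of nonzero integers `(x₁,…,xₙ,y₁,…,y_{n/k})` satisfying
`∑ xᵢ = k·∑ yⱼ` and `∑ xᵢ³ = k·∑ yⱼ³`, which are nontrivial in the sense that no entry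
equals plus or minus another entry (in the stated forbidden positions). -/
theorem stmt0 (n k : ℕ) (hn : 3 ≤ n) (hkpos : 0 < k) (hdvd : k ∣ n) (hkn : k ≠ n)
    (hq : 2 ≤ n / k) :
    {p : (Fin n → ℤ) × (Fin (n / k) → ℤ) |
      (∀ i, p.1 i ≠ 0) ∧ (∀ j, p.2 j ≠ 0) ∧
      (∑ i, p.1 i) = (k : ℤ) * (∑ j, p.2 j) ∧
      (∑ i, (p.1 i) ^ 3) = (k : ℤ) * (∑ j, (p.2 j) ^ 3) ∧
      (∀ i j, i ≠ j → p.1 i ≠ p.1 j ∧ p.1 i ≠ -(p.1 j)) ∧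
      (∀ i j, i ≠ j → p.2 i ≠ p.2 j ∧ p.2 i ≠ -(p.2 j)) ∧
      (∀ i j, p.1 i ≠ p.2 j ∧ p.1 i ≠ -(p.2 j))}.Infinite := by
  have hmul : n = n / k * k := (Nat.div_mul_cancel hdvd).symm
  generalize n / k = m at *
  have hsol : ∃ (X : Fin m × Fin k → ℤ) (Y : Fin m → ℤ),
      (∀ a, 0 < X a) ∧ (∀ j, 0 < Y j) ∧ Function.Injective X ∧ Function.Injective Y ∧
      (∀ a j, X a ≠ Y j) ∧ ∑ a, X a = (k : ℤ) * ∑ j, Y j ∧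
      ∑ a, X a ^ 3 = (k : ℤ) * ∑ j, Y j ^ 3 := by
    obtain rfl | hm : m = 2 ∨ 3 ≤ m := by omega
    · exact exists_pos_solution_two k (by omega)
    · exact exists_pos_solution_of_three_le m k hm hkpos
  obtain ⟨X, Y, hX, hY, hXi, hYi, hXY, h₁, h₃⟩ := hsol
  exact infinite_of_pos_solution n m k (by omega) hmul X Y hX hY hXi hYi hXY h₁ h₃
end

section
/- Let k ≥ 1 and r ≥ 1 be integers, and let x₁, …, x_n, y₁, …, y_r and X₁, …, X_n, Y₁, …, Y_r be integers such that Σᵢ xᵢ³ = k·Σⱼ yⱼ³ and Σᵢ Xᵢ³ = k·Σⱼ Yⱼ³. Define A = Σᵢ xᵢ²Xᵢ − k·Σⱼ yⱼ²Yⱼ and B = k·Σⱼ yⱼYⱼ² − Σᵢ xᵢXᵢ². Then the tuple (x₁B + AX₁, …, x_nB + AX_n, y₁B + AY₁, …, y_rB + AY_r) again satisfies Σᵢ (xᵢB + AXᵢ)³ = k·Σⱼ (yⱼB + AYⱼ)³. Moreover, if additionally Σᵢ xᵢ = k·Σⱼ yⱼ and Σᵢ Xᵢ = k·Σⱼ Yⱼ,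 then also Σᵢ (xᵢB + AXᵢ) = k·Σⱼ (yⱼB + AYⱼ). -/
theorem Finset.sum_linear_comb_cube {ι R : Type*} [CommRing R] (s : Finset ι) (u v : ι → R)
    (a b : R) :
    ∑ i ∈ s, (u i * b + a * v i) ^ 3 =
      b ^ 3 * ∑ i ∈ s, u i ^ 3 + 3 * a * b ^ 2 * ∑ i ∈ s, u i ^ 2 * v i +
        3 * a ^ 2 * b * ∑ i ∈ s, u i * v i ^ 2 + a ^ 3 * ∑ i ∈ s, v i ^ 3 := by
  simp only [Finset.mul_sum, ← Finset.sum_add_distrib]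
  exact Finset.sum_congr rfl fun i _ => by ring

/-- If `x, X : Fin n → ℤ` and `y, Y : Fin r → ℤ` are two solutions of
`∑ xᵢ³ = k·∑ yⱼ³` (with `k ≥ 1`, `r ≥ 1`), then with
`A = ∑ xᵢ²Xᵢ − k·∑ yⱼ²Yⱼ` and `B = k·∑ yⱼYⱼ² − ∑ xᵢXᵢ²`, the tuple
`(xᵢB + AXᵢ, yⱼB + AYⱼ)` is again a solution of the cubic equation; moreover if both
tuples also satisfy the linear equation `∑ xᵢ = k·∑ yⱼ`, then so does the new tuple. -/
theorem stmt1 (n r : ℕ) (hr : 1 ≤ r) (k : ℤ) (hk : 1 ≤ k)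
    (x X : Fin n → ℤ) (y Y : Fin r → ℤ)
    (h1 : ∑ i, (x i) ^ 3 = k * ∑ j, (y j) ^ 3)
    (h2 : ∑ i, (X i) ^ 3 = k * ∑ j, (Y j) ^ 3)
    (A B : ℤ)
    (hA : A = ∑ i, (x i) ^ 2 * X i - k * ∑ j, (y j) ^ 2 * Y j)
    (hB : B = k * ∑ j, y j * (Y j) ^ 2 - ∑ i, x i * (X i) ^ 2) :
    (∑ i, (x i * B + A * X i) ^ 3 = k * ∑ j, (y j * B + A * Y j) ^ 3) ∧
    ((∑ i, x i = k * ∑ j, y j) → (∑ i, X i = k * ∑ j, Y j) →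
      ∑ i, (x i * B + A * X i) = k * ∑ j, (y j * B + A * Y j)) := by
  refine ⟨?_, fun hx hX => ?_⟩
  · rw [Finset.sum_linear_comb_cube, Finset.sum_linear_comb_cube]
    linear_combination B ^ 3 * h1 + A ^ 3 * h2 - 3 * A * B ^ 2 * hA + 3 * A ^ 2 * B * hB
  · simp only [Finset.sum_add_distrib, ← Finset.sum_mul, ← Finset.mul_sum]
    linear_combination B * hx + A * hX
end

section
/- Let n, m ≥ 1, let a₁, …, a_n and b₁, …, b_m be positive integers, and let p₁, …, p_n and q₁, …, q_m be integers. Suppose p₁ = 1 and gcd(a₁, a₂·a₃⋯a_n·b₁·b₂⋯b_m) = 1, and suppose there exist integers s₁, …, s_m and t₂, …, t_n, all nonzero, such that the integer M = q₁s₁^{b₁} + ⋯ + q_m s_m^{b_m} − p₂t₂^{a₂} − ⋯ − p_n t_n^{a_n} satisfies |M| ≥ 2. Then the Diophantine equation p₁x₁^{a₁} + p₂x₂^{a₂} + ⋯ + p_n x_n^{a_n} = q₁y₁^{b₁} + ⋯ + q_m y_m^{b_m} has infinitely many solutions in nonzero integers x₁, …, x_n, y₁, …, y_m. -/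
open Finset

/-- For coprime positive `A`, `B` there are natural numbers with `A * u = 1 + B * v`. -/
theorem exists_mul_eq_one_add_mul_of_coprime {A B : ℕ} (hA : 0 < A) (hB : 0 < B)
    (h : A.Coprime B) : ∃ u v : ℕ, A * u = 1 + B * v := by
  obtain ⟨z, hzA, hzB⟩ := Nat.chineseRemainder h 0 1
  obtain ⟨u, hu⟩ : A ∣ z + A * B :=
    (Nat.dvd_add_left (dvd_mul_right A B)).2 ((Nat.modEq_zero_iff_dvd).1 hzA)
  have hpos : 1 ≤ z + A * B := (Nat.mul_pos hA hB).trans_le (Nat.le_add_left _ _)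
  have hmod : 1 ≡ z + A * B [MOD B] := by
    simpa [Nat.ModEq] using hzB.symm
  obtain ⟨v, hv⟩ := (Nat.modEq_iff_dvd' hpos).1 hmod
  exact ⟨u, v, by omega⟩

/-- Consider the Diophantine equation
`∑ᵢ pᵢ·xᵢ^{aᵢ} = ∑ⱼ qⱼ·yⱼ^{bⱼ}` with `n, m ≥ 1`, positive exponents, `p₁ = 1`, and
`gcd(a₁, a₂⋯aₙ·b₁⋯bₘ) = 1`. If there exist nonzero integers `s₁,…,sₘ` and `t₂,…,tₙ`
such that `M = ∑ⱼ qⱼsⱼ^{bⱼ} − ∑_{i≥2} pᵢtᵢ^{aᵢ}` satisfies `|M| ≥ 2`, then the equation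
has infinitely many solutions in nonzero integers. -/
theorem stmt2 (n m : ℕ) (hn : 0 < n) (hm : 0 < m)
    (a : Fin n → ℕ) (b : Fin m → ℕ) (ha : ∀ i, 0 < a i) (hb : ∀ j, 0 < b j)
    (p : Fin n → ℤ) (q : Fin m → ℤ)
    (hp1 : p ⟨0, hn⟩ = 1)
    (hgcd : Nat.Coprime (a ⟨0, hn⟩)
      ((∏ i ∈ univ.erase ⟨0, hn⟩, a i) * ∏ j, b j))
    (hM : ∃ (s : Fin m → ℤ) (t : Fin n → ℤ),
      (∀ j, s j ≠ 0) ∧ (∀ i, i ≠ (⟨0, hn⟩ : Fin n) → t i ≠ 0) ∧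
      2 ≤ |∑ j, q j * s j ^ b j - ∑ i ∈ univ.erase ⟨0, hn⟩, p i * t i ^ a i|) :
    {z : (Fin n → ℤ) × (Fin m → ℤ) |
      (∀ i, z.1 i ≠ 0) ∧ (∀ j, z.2 j ≠ 0) ∧
      ∑ i, p i * (z.1 i) ^ a i = ∑ j, q j * (z.2 j) ^ b j}.Infinite := by
  obtain ⟨s, t, hs, ht, hM⟩ := hM
  set i₀ : Fin n := ⟨0, hn⟩
  set M : ℤ := ∑ j, q j * s j ^ b j - ∑ i ∈ univ.erase i₀, p i * t i ^ a i with hMdef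
  set B : ℕ := (∏ i ∈ univ.erase i₀, a i) * ∏ j, b j
  have hB : 0 < B := Nat.mul_pos (prod_pos fun i _ => ha i) (prod_pos fun j _ => hb j)
  have hM0 : M ≠ 0 := fun h => by simp [h] at hM
  have haB : ∀ i, i ≠ i₀ → a i ∣ B := fun i hi =>
    (dvd_prod_of_mem a (mem_erase.2 ⟨hi, mem_univ i⟩)).mul_right _
  have hbB : ∀ j, b j ∣ B := fun j => (dvd_prod_of_mem b (mem_univ j)).mul_left _
  obtain ⟨u, v, huv⟩ := exists_mul_eq_one_add_mul_of_coprime (ha i₀) hB hgcd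
  let x : ℕ → Fin n → ℤ := fun k i =>
    if i = i₀ then M ^ (u + B * k) else t i * M ^ (B / a i * (v + a i₀ * k))
  let y : ℕ → Fin m → ℤ := fun k j => s j * M ^ (B / b j * (v + a i₀ * k))
  refine Set.infinite_of_injective_forall_mem (f := fun k => (x k, y k)) ?_ ?_
  · intro k l hkl
    have h : M ^ (u + B * k) = M ^ (u + B * l) := by
      simpa [x] using congrFun (congrArg Prod.fst hkl) i₀
    have hnat : 2 ≤ M.natAbs := by
      rw [Int.abs_eq_natAbs] at hM
      exact_mod_cast hM
    have h' : M.natAbs ^ (u + B * k) = M.natAbs ^ (u + B * l) := by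
      simpa only [Int.natAbs_pow] using congrArg Int.natAbs h
    exact Nat.eq_of_mul_eq_mul_left hB (Nat.add_left_cancel (Nat.pow_right_injective hnat h'))
  · intro k
    refine ⟨fun i => ?_, fun j => mul_ne_zero (hs j) (pow_ne_zero _ hM0), ?_⟩
    · by_cases hi : i = i₀
      · simpa only [x, if_pos hi] using pow_ne_zero _ hM0
      · simpa only [x, if_neg hi] using mul_ne_zero (ht i hi) (pow_ne_zero _ hM0)
    · have hpow : ∀ (c : ℤ) (d : ℕ), d ∣ B →
          (c * M ^ (B / d * (v + a i₀ * k))) ^ d = c ^ d * M ^ (B * (v + a i₀ * k)) := by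
        intro c d hd
        rw [mul_pow, ← pow_mul, mul_right_comm, Nat.div_mul_cancel hd]
      have hx₀ : p i₀ * x k i₀ ^ a i₀ = M * M ^ (B * (v + a i₀ * k)) := by
        have he : (u + B * k) * a i₀ = B * (v + a i₀ * k) + 1 := by linear_combination huv
        simp only [x, if_true, hp1, one_mul]
        rw [← pow_mul, he, pow_succ']
      have hx : ∑ i ∈ univ.erase i₀, p i * x k i ^ a i
          = (∑ i ∈ univ.erase i₀, p i * t i ^ a i) * M ^ (B * (v + a i₀ * k)) := by
        rw [sum_mul]
        refine sum_congr rfl fun i hi => ?_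
        have hi' := ne_of_mem_erase hi
        simp only [x, if_neg hi']
        rw [hpow _ _ (haB i hi'), ← mul_assoc]
      have hy : ∑ j, q j * y k j ^ b j
          = (∑ j, q j * s j ^ b j) * M ^ (B * (v + a i₀ * k)) := by
        rw [sum_mul]
        refine sum_congr rfl fun j _ => ?_
        simp only [y]
        rw [hpow _ _ (hbB j), ← mul_assoc]
      change ∑ i, p i * x k i ^ a i = ∑ j, q j * y k j ^ b j
      rw [← add_sum_erase _ _ (mem_univ i₀), hx₀, hx, hy, ← add_mul, hMdef, sub_add_cancel]
end

section
/- Let a, b, c be positive integers with gcd(c, a·b) = 1. Then the Diophantine equation x^a + y^b = z^c has infinitely many solutions in positive integers x, y, z. -/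
/-- If `c` is positive and coprime to the positive integer `n`, then some multiple of `c` exceeds
some multiple of `n` by one. -/
theorem Nat.Coprime.exists_mul_add_one_eq_mul {n c : ℕ} (hn : 0 < n) (hc : 0 < c)
    (h : Nat.Coprime c n) : ∃ u m : ℕ, n * u + 1 = c * m := by
  obtain ⟨N, hN0, hN1⟩ := Nat.chineseRemainder h 0 1
  obtain ⟨m, hm⟩ := (Nat.modEq_zero_iff_dvd.mp hN0)
  have hpos : 1 ≤ N + c * n := Nat.le_add_left_of_le (Nat.mul_pos hc hn)
  have hmod : 1 ≡ N + c * n [MOD n] := by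
    simpa [Nat.ModEq] using hN1.symm
  obtain ⟨u, hu⟩ := (Nat.modEq_iff_dvd' hpos).mp hmod
  exact ⟨u, m + n, by rw [← hu, Nat.sub_add_cancel hpos, hm, mul_add]⟩

/-- If `a, b, c` are positive integers with `gcd(c, a·b) = 1`, then
`x^a + y^b = z^c` has infinitely many solutions in positive integers. -/
theorem stmt4 (a b c : ℕ) (ha : 0 < a) (hb : 0 < b) (hc : 0 < c)
    (h : Nat.Coprime c (a * b)) :
    {p : ℕ × ℕ × ℕ | 0 < p.1 ∧ 0 < p.2.1 ∧ 0 < p.2.2 ∧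
      p.1 ^ a + p.2.1 ^ b = p.2.2 ^ c}.Infinite := by
  have hab : 0 < a * b := Nat.mul_pos ha hb
  obtain ⟨u, m, hum⟩ := h.exists_mul_add_one_eq_mul hab hc
  refine Set.infinite_of_injective_forall_mem
    (f := fun k : ℕ => (2 ^ (b * (u + c * k)), 2 ^ (a * (u + c * k)), 2 ^ (m + a * b * k))) ?_ ?_
  · intro k l hkl
    have hz := Nat.pow_right_injective le_rfl (congrArg (fun p => p.2.2) hkl)
    exact Nat.eq_of_mul_eq_mul_left hab (Nat.add_left_cancel hz)
  · intro k
    refine ⟨by positivity, by positivity, by positivity, ?_⟩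
    have hx : b * (u + c * k) * a = a * b * (u + c * k) := by ring
    have hy : a * (u + c * k) * b = a * b * (u + c * k) := by ring
    have hz : (m + a * b * k) * c = a * b * (u + c * k) + 1 := by linear_combination -hum
    simp only [← pow_mul, hx, hy, hz]
    rw [pow_succ, mul_two]
end

section
/- Let k ≥ 1 and r ≥ 1 be integers and set n = k·r. Let x₁, …, x_n and y₁, …, y_r be integers with Σᵢ₌₁ⁿ xᵢ³ = k·Σⱼ₌₁ʳ yⱼ³. Define s = x₁ + ⋯ + x_n − k·(y₁ + ⋯ + y_r) and t = −2(x₁² + ⋯ + x_n²) + 2k·(y₁² + ⋯ + y_r²). Then Σᵢ₌₁ⁿ (2xᵢs + t)³ = k·Σⱼ₌₁ʳ (2yⱼs + t)³. -/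
theorem sum_two_mul_mul_add_cube {ι R : Type*} [Fintype ι] [CommRing R] (f : ι → R) (s t : R) :
    ∑ i, (2 * f i * s + t) ^ 3 =
      8 * s ^ 3 * ∑ i, f i ^ 3 + 12 * s ^ 2 * t * ∑ i, f i ^ 2 + 6 * s * t ^ 2 * ∑ i, f i +
        Fintype.card ι * t ^ 3 := by
  have expand (i : ι) : (2 * f i * s + t) ^ 3 =
      8 * s ^ 3 * f i ^ 3 + 12 * s ^ 2 * t * f i ^ 2 + 6 * s * t ^ 2 * f i + t ^ 3 := by ring
  simp only [expand, Finset.sum_add_distrib, ← Finset.mul_sum, Finset.sum_const,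
    Finset.card_univ, nsmul_eq_mul]

/-- From a solution `(x, y)` of `∑_{i=1}^{kr} xᵢ³ = k·∑_{j=1}^{r} yⱼ³`,
setting `s = ∑ xᵢ − k·∑ yⱼ` and `t = −2∑ xᵢ² + 2k·∑ yⱼ²`, the tuple
`(2xᵢs + t, 2yⱼs + t)` is again a solution. -/
theorem stmt5 (k r : ℕ) (hk : 1 ≤ k) (hr : 1 ≤ r)
    (x : Fin (k * r) → ℤ) (y : Fin r → ℤ)
    (h : ∑ i, (x i) ^ 3 = (k : ℤ) * ∑ j, (y j) ^ 3)
    (s t : ℤ)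
    (hs : s = ∑ i, x i - (k : ℤ) * ∑ j, y j)
    (ht : t = -2 * ∑ i, (x i) ^ 2 + 2 * (k : ℤ) * ∑ j, (y j) ^ 2) :
    ∑ i, (2 * x i * s + t) ^ 3 = (k : ℤ) * ∑ j, (2 * y j * s + t) ^ 3 := by
  rw [sum_two_mul_mul_add_cube, sum_two_mul_mul_add_cube, h]
  simp only [Fintype.card_fin, Nat.cast_mul]
  linear_combination -6 * s * t ^ 2 * hs + 6 * s ^ 2 * t * ht
end

section
/- Let B and C be odd positive integers with gcd(B, C) = 1. Then the Diophantine equation x² + y^{2B} = z^{2C} has infinitely many solutions in positive integers x, y, z. -/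
theorem exists_dvd_succ_and_dvd {m n : ℕ} (hm : 0 < m) (h : m.Coprime n) :
    ∃ k, m ∣ k + 1 ∧ n ∣ k := by
  obtain ⟨k, hkm, hkn⟩ := Nat.chineseRemainder h (m - 1) 0
  refine ⟨k, ?_, (Nat.modEq_zero_iff_dvd).1 hkn⟩
  have hk := hkm.add_right 1
  rw [Nat.sub_add_cancel hm] at hk
  exact (hk.dvd_iff dvd_rfl).2 dvd_rfl

/-- For coprime positive exponents `m, n`, any two positive integers `a, b` have a common
multiplier making the first an `m`-th power and the second an `n`-th power. -/
theorem exists_mul_eq_pow_and_mul_eq_pow {m n : ℕ} (hm : 0 < m) (hn : 0 < n)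
    (h : m.Coprime n) {a b : ℕ} (ha : 0 < a) (hb : 0 < b) :
    ∃ N u v : ℕ, 0 < N ∧ 0 < u ∧ 0 < v ∧ a * N = u ^ m ∧ b * N = v ^ n := by
  obtain ⟨i, ⟨i₁, hi₁⟩, ⟨i₂, hi₂⟩⟩ := exists_dvd_succ_and_dvd hm h
  obtain ⟨j, ⟨j₁, hj₁⟩, ⟨j₂, hj₂⟩⟩ := exists_dvd_succ_and_dvd hn h.symm
  refine ⟨a ^ i * b ^ j, a ^ i₁ * b ^ j₂, a ^ i₂ * b ^ j₁,
    by positivity, by positivity, by positivity, ?_, ?_⟩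
  · rw [mul_pow, ← pow_mul, ← pow_mul, mul_comm i₁, mul_comm j₂, ← hi₁, ← hj₂]
    ring
  · rw [mul_pow, ← pow_mul, ← pow_mul, mul_comm i₂, mul_comm j₁, ← hi₂, ← hj₁]
    ring

/-- For odd coprime positive integers `B, C`, the equation
`x² + y^{2B} = z^{2C}` has infinitely many solutions in positive integers. -/
theorem stmt6 (B C : ℕ) (hBpos : 0 < B) (hCpos : 0 < C)
    (hB : Odd B) (hC : Odd C) (h : Nat.Coprime B C) :
    {p : ℕ × ℕ × ℕ | 0 < p.1 ∧ 0 < p.2.1 ∧ 0 < p.2.2 ∧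
      p.1 ^ 2 + p.2.1 ^ (2 * B) = p.2.2 ^ (2 * C)}.Infinite := by
  obtain ⟨N, u, v, hN, hu, hv, huN, hvN⟩ :=
    exists_mul_eq_pow_and_mul_eq_pow hBpos hCpos h (a := 3) (b := 5) (by norm_num) (by norm_num)
  refine Set.infinite_of_injective_forall_mem
    (f := fun t : ℕ ↦ (4 * N * (t + 1) ^ (B * C), u * (t + 1) ^ C, v * (t + 1) ^ B)) ?_ ?_
  · intro s t hst
    have hpow : (s + 1) ^ C = (t + 1) ^ C :=
      Nat.eq_of_mul_eq_mul_left hu (congrArg (fun p ↦ p.2.1) hst)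
    exact Nat.succ_injective (Nat.pow_left_injective hCpos.ne' hpow)
  · intro t
    refine ⟨by positivity, by positivity, by positivity, ?_⟩
    have hy : (u * (t + 1) ^ C) ^ B = 3 * N * (t + 1) ^ (B * C) := by
      rw [mul_pow, ← huN, ← pow_mul, mul_comm C]
    have hz : (v * (t + 1) ^ B) ^ C = 5 * N * (t + 1) ^ (B * C) := by
      rw [mul_pow, ← hvN, ← pow_mul]
    dsimp only
    rw [mul_comm 2 B, mul_comm 2 C, pow_mul _ B 2, pow_mul _ C 2, hy, hz]
    ring
end

section
/- Let A be a positive integer and let B, C be odd positive integers with gcd(A, C) = 1 and gcd(A·C, B) = 1. Then the Diophantine equation x^{4A} + y^{2B} = z^{2C} has infinitely many solutions in positive integers x, y, z. -/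
theorem Nat.Coprime.exists_dvd_and_dvd_add_one {m n : ℕ} (hm : 0 < m) (h : Nat.Coprime m n) :
    ∃ k, n ∣ k ∧ m ∣ k + 1 := by
  obtain ⟨k, hkm, hkn⟩ := Nat.chineseRemainder h (m - 1) 0
  refine ⟨k, (Nat.modEq_zero_iff_dvd).1 hkn, (Nat.modEq_zero_iff_dvd).1 ?_⟩
  have h1 := hkm.add_right 1
  rw [Nat.sub_add_cancel hm] at h1
  exact h1.trans (by simp [Nat.ModEq])

/-- Any positive integers `u, v, w` have a common positive multiplier `s` turning them into a
`P`-th, a `Q`-th and an `R`-th power, for pairwise coprime `P, Q, R`. -/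
theorem exists_mul_eq_pow_of_pairwise_coprime {P Q R u v w : ℕ}
    (hP : 0 < P) (hQ : 0 < Q) (hR : 0 < R) (hPQ : Nat.Coprime P Q) (hPR : Nat.Coprime P R)
    (hQR : Nat.Coprime Q R) (hu : 0 < u) (hv : 0 < v) (hw : 0 < w) :
    ∃ s x y z : ℕ, 0 < x ∧ 0 < y ∧ 0 < z ∧ u * s = x ^ P ∧ v * s = y ^ Q ∧ w * s = z ^ R := by
  obtain ⟨α, hα, a₁, ha₁⟩ := (hPQ.mul_right hPR).exists_dvd_and_dvd_add_one hP
  obtain ⟨β, hβ, b₂, hb₂⟩ := (hPQ.symm.mul_right hQR).exists_dvd_and_dvd_add_one hQ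
  obtain ⟨γ, hγ, c₃, hc₃⟩ := (hPR.symm.mul_right hQR.symm).exists_dvd_and_dvd_add_one hR
  obtain ⟨b₁, hb₁⟩ := dvd_of_mul_right_dvd hα
  obtain ⟨c₁, hc₁⟩ := dvd_of_mul_left_dvd hα
  obtain ⟨a₂, ha₂⟩ := dvd_of_mul_right_dvd hβ
  obtain ⟨c₂, hc₂⟩ := dvd_of_mul_left_dvd hβ
  obtain ⟨a₃, ha₃⟩ := dvd_of_mul_right_dvd hγ
  obtain ⟨b₃, hb₃⟩ := dvd_of_mul_left_dvd hγ
  refine ⟨u ^ α * v ^ β * w ^ γ, u ^ a₁ * v ^ a₂ * w ^ a₃, u ^ b₁ * v ^ b₂ * w ^ b₃,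
    u ^ c₁ * v ^ c₂ * w ^ c₃, by positivity, by positivity, by positivity, ?_, ?_, ?_⟩
  · calc u * (u ^ α * v ^ β * w ^ γ) = u ^ (α + 1) * v ^ β * w ^ γ := by ring
      _ = _ := by rw [ha₁, ha₂, ha₃]; ring
  · calc v * (u ^ α * v ^ β * w ^ γ) = u ^ α * v ^ (β + 1) * w ^ γ := by ring
      _ = _ := by rw [hb₁, hb₂, hb₃]; ring
  · calc w * (u ^ α * v ^ β * w ^ γ) = u ^ α * v ^ β * w ^ (γ + 1) := by ring
      _ = _ := by rw [hc₁, hc₂, hc₃]; ring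

/-- For a positive integer `A` and odd positive integers `B, C` with
`gcd(A, C) = 1` and `gcd(A·C, B) = 1`, the equation `x^{4A} + y^{2B} = z^{2C}` has
infinitely many solutions in positive integers. -/
theorem stmt9 (A B C : ℕ) (hApos : 0 < A) (hBpos : 0 < B) (hCpos : 0 < C)
    (hB : Odd B) (hC : Odd C)
    (hAC : Nat.Coprime A C) (hACB : Nat.Coprime (A * C) B) :
    {p : ℕ × ℕ × ℕ | 0 < p.1 ∧ 0 < p.2.1 ∧ 0 < p.2.2 ∧
      p.1 ^ (4 * A) + p.2.1 ^ (2 * B) = p.2.2 ^ (2 * C)}.Infinite := by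
  obtain ⟨hAB, hCB⟩ := Nat.coprime_mul_iff_left.1 hACB
  obtain ⟨s, x, y, z, hx, hy, hz, hxs, hys, hzs⟩ :=
    exists_mul_eq_pow_of_pairwise_coprime (P := 2 * A) (u := 3) (v := 4) (w := 5)
      (by positivity) hBpos hCpos ((Nat.coprime_two_left.2 hB).mul_left hAB)
      ((Nat.coprime_two_left.2 hC).mul_left hAC) hCB.symm
      (by norm_num) (by norm_num) (by norm_num)
  have hxyz : x ^ (4 * A) + y ^ (2 * B) = z ^ (2 * C) := by
    calc x ^ (4 * A) + y ^ (2 * B) = (x ^ (2 * A)) ^ 2 + (y ^ B) ^ 2 := by ring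
      _ = (z ^ C) ^ 2 := by rw [← hxs, ← hys, ← hzs]; ring
      _ = z ^ (2 * C) := by ring
  refine Set.infinite_of_injective_forall_mem (f := fun t : ℕ ↦
    (x * (t + 1) ^ (B * C), y * (t + 1) ^ (2 * A * C), z * (t + 1) ^ (2 * A * B))) ?_ ?_
  · intro t t' h
    have h1 := Nat.eq_of_mul_eq_mul_left hx (Prod.ext_iff.1 h).1
    exact Nat.succ_injective (Nat.pow_left_injective (mul_pos hBpos hCpos).ne' h1)
  · intro t
    refine ⟨by positivity, by positivity, by positivity, ?_⟩
    calc (x * (t + 1) ^ (B * C)) ^ (4 * A) + (y * (t + 1) ^ (2 * A * C)) ^ (2 * B)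
        = (x ^ (4 * A) + y ^ (2 * B)) * (t + 1) ^ (4 * A * B * C) := by
          simp only [mul_pow, ← pow_mul, add_mul]; congr 3 <;> ring
      _ = (z * (t + 1) ^ (2 * A * B)) ^ (2 * C) := by
          rw [hxyz, mul_pow, ← pow_mul]; congr 2; ring
end

section
/- For all integers u and v, define a = −u² − uv + uv³ + 2u⁴ − vu² + v³ − v⁴, b = −u²v² − uv − uv³ + 2u⁴ + 2u³v − u²v − v² + v³ + 2u³ − 2uv², c = −v⁴ + 2u²v² − v³ − 2u³ − u² − uv − uv³ + 2u³v + u²v + 2uv², d = u²v² − 3uv³ + 4u³v − uv − v² + vu² − v³, e = u²v² − u² − u³ − uv − 2uv³ + 3u³v + uv², and f = −uv − v² − v⁴ + u³v + u³ − uv² + 2u⁴. Then a + b + c + d = 2(e + f) and a³ + b³ + c³ + d³ = 2(e³ + f³). -/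
/-- Explicit two-parameter polynomial solution of the simultaneous system
`a + b + c + d = 2(e + f)` and `a³ + b³ + c³ + d³ = 2(e³ + f³)`. -/
theorem stmt12 (u v : ℤ)
    (a b c d e f : ℤ)
    (ha : a = -u^2 - u*v + u*v^3 + 2*u^4 - v*u^2 + v^3 - v^4)
    (hb : b = -u^2*v^2 - u*v - u*v^3 + 2*u^4 + 2*u^3*v - u^2*v - v^2 + v^3 + 2*u^3 - 2*u*v^2)
    (hc : c = -v^4 + 2*u^2*v^2 - v^3 - 2*u^3 - u^2 - u*v - u*v^3 + 2*u^3*v + u^2*v + 2*u*v^2)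
    (hd : d = u^2*v^2 - 3*u*v^3 + 4*u^3*v - u*v - v^2 + v*u^2 - v^3)
    (he : e = u^2*v^2 - u^2 - u^3 - u*v - 2*u*v^3 + 3*u^3*v + u*v^2)
    (hf : f = -u*v - v^2 - v^4 + u^3*v + u^3 - u*v^2 + 2*u^4) :
    a + b + c + d = 2 * (e + f) ∧
    a^3 + b^3 + c^3 + d^3 = 2 * (e^3 + f^3) := by
  subst ha hb hc hd he hf
  constructor <;> ring
end

section
/- The Diophantine equation x⁵ = 6·(y₁⁷ + y₂⁷ + y₃⁷) has infinitely many solutions in nonzero integers x, y₁, y₂, y₃. -/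
/-- `x⁵ = 6·(y₁⁷ + y₂⁷ + y₃⁷)` has infinitely many solutions in nonzero
integers. -/
theorem stmt15 :
    {p : ℤ × ℤ × ℤ × ℤ | p.1 ≠ 0 ∧ p.2.1 ≠ 0 ∧ p.2.2.1 ≠ 0 ∧ p.2.2.2 ≠ 0 ∧
      p.1 ^ 5 = 6 * (p.2.1 ^ 7 + p.2.2.1 ^ 7 + p.2.2.2 ^ 7)}.Infinite := by
  refine Set.infinite_of_injective_forall_mem
    (f := fun n : ℕ ↦ ((18 ^ 3 * ((n : ℤ) + 1) ^ 7, 18 ^ 2 * ((n : ℤ) + 1) ^ 5,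
      18 ^ 2 * ((n : ℤ) + 1) ^ 5, 18 ^ 2 * ((n : ℤ) + 1) ^ 5) : ℤ × ℤ × ℤ × ℤ)) ?_ ?_
  · intro m n h
    have h₁ : (18 : ℤ) ^ 3 * ((m : ℤ) + 1) ^ 7 = 18 ^ 3 * ((n : ℤ) + 1) ^ 7 :=
      congrArg Prod.fst h
    have h₂ : ((m : ℤ) + 1) ^ 7 = ((n : ℤ) + 1) ^ 7 :=
      mul_left_cancel₀ (by norm_num) h₁
    have h₃ : (m : ℤ) + 1 = n + 1 :=
      (pow_left_inj₀ (by positivity) (by positivity) (by norm_num)).1 h₂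
    lia
  · intro n
    refine ⟨by positivity, by positivity, by positivity, by positivity, ?_⟩
    ring
end

section
/- The Diophantine equation x⁷ = 13·y₁¹¹ + 11·y₂¹³ has infinitely many solutions in nonzero integers x, y₁, y₂. -/
/-- Scaling the base `a = b + c` gives a parametric family of solutions. -/
theorem add_eq_imp_parametric_solution {R : Type*} [CommRing R] {a b c : R} (h : a = b + c)
    (t : R) :
    (a ^ 41 * t ^ 143) ^ 7 = b * (a ^ 26 * t ^ 91) ^ 11 + c * (a ^ 22 * t ^ 77) ^ 13 := by
  calc (a ^ 41 * t ^ 143) ^ 7 = a * (a ^ 286 * t ^ 1001) := by ring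
    _ = (b + c) * (a ^ 286 * t ^ 1001) := by rw [← h]
    _ = _ := by
      simp only [mul_pow, ← pow_mul]
      exact add_mul _ _ _

/-- `x⁷ = 13·y₁¹¹ + 11·y₂¹³` has infinitely many solutions in nonzero
integers. -/
theorem stmt16 :
    {p : ℤ × ℤ × ℤ | p.1 ≠ 0 ∧ p.2.1 ≠ 0 ∧ p.2.2 ≠ 0 ∧
      p.1 ^ 7 = 13 * p.2.1 ^ 11 + 11 * p.2.2 ^ 13}.Infinite := by
  obtain ⟨a, ha⟩ : ∃ a : ℤ, a = 13 + 11 := ⟨_, rfl⟩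
  have ha0 : a ≠ 0 := by rw [ha]; norm_num
  refine Set.infinite_of_injective_forall_mem (f := fun n : ℕ =>
    (a ^ 41 * ((n : ℤ) + 1) ^ 143, a ^ 26 * ((n : ℤ) + 1) ^ 91, a ^ 22 * ((n : ℤ) + 1) ^ 77))
    (fun m n hmn => ?_) (fun n => ?_)
  · have hpow := mul_left_cancel₀ (pow_ne_zero 41 ha0) (Prod.ext_iff.mp hmn).1
    have hodd : Odd 143 := by decide
    have := hodd.strictMono_pow.injective hpow
    omega
  · have hn : (n : ℤ) + 1 ≠ 0 := by positivity
    exact ⟨mul_ne_zero (pow_ne_zero _ ha0) (pow_ne_zero _ hn),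
      mul_ne_zero (pow_ne_zero _ ha0) (pow_ne_zero _ hn),
      mul_ne_zero (pow_ne_zero _ ha0) (pow_ne_zero _ hn),
      add_eq_imp_parametric_solution ha _⟩
end

section
/- The Diophantine equation x₁⁵ + x₂⁶ = y₁⁷ + y₂⁸ + y₃⁹ has infinitely many solutions in nonzero integers x₁, x₂, y₁, y₂, y₃. -/
theorem weighted_power_identity {R : Type*} [CommRing R] {a : R} (ha : a = 1715) (t : R) :
    (a ^ 101 * t ^ 504) ^ 5 + (3 * a ^ 84 * t ^ 420) ^ 6 =
      (3 * a ^ 72 * t ^ 360) ^ 7 + (2 * a ^ 63 * t ^ 315) ^ 8 + (a ^ 56 * t ^ 280) ^ 9 := by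
  simp only [mul_pow, ← pow_mul]
  norm_num only
  linear_combination a ^ 504 * t ^ 2520 * ha

/-- `x₁⁵ + x₂⁶ = y₁⁷ + y₂⁸ + y₃⁹` has infinitely many solutions in
nonzero integers. -/
theorem stmt17 :
    {p : ℤ × ℤ × ℤ × ℤ × ℤ |
      p.1 ≠ 0 ∧ p.2.1 ≠ 0 ∧ p.2.2.1 ≠ 0 ∧ p.2.2.2.1 ≠ 0 ∧ p.2.2.2.2 ≠ 0 ∧
      p.1 ^ 5 + p.2.1 ^ 6 = p.2.2.1 ^ 7 + p.2.2.2.1 ^ 8 + p.2.2.2.2 ^ 9}.Infinite := by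
  obtain ⟨a, ha⟩ : ∃ a : ℤ, a = 1715 := ⟨_, rfl⟩
  have ha0 : a ≠ 0 := by omega
  refine Set.infinite_of_injective_forall_mem (f := fun n : ℕ =>
    (a ^ 101 * ((n : ℤ) + 1) ^ 504, 3 * a ^ 84 * ((n : ℤ) + 1) ^ 420,
      3 * a ^ 72 * ((n : ℤ) + 1) ^ 360, 2 * a ^ 63 * ((n : ℤ) + 1) ^ 315,
      a ^ 56 * ((n : ℤ) + 1) ^ 280)) ?_ ?_
  · intro m n h
    have h1 : a ^ 101 * ((m : ℤ) + 1) ^ 504 = a ^ 101 * ((n : ℤ) + 1) ^ 504 :=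
      congrArg Prod.fst h
    have h2 := mul_left_cancel₀ (pow_ne_zero 101 ha0) h1
    have hm : 0 ≤ (m : ℤ) + 1 := by omega
    have hn : 0 ≤ (n : ℤ) + 1 := by omega
    have h3 : (m : ℤ) + 1 = n + 1 := (pow_left_inj₀ hm hn (by norm_num)).mp h2
    omega
  · intro n
    have hn : (n : ℤ) + 1 ≠ 0 := by positivity
    have three : (3 : ℤ) ≠ 0 := by norm_num
    have two : (2 : ℤ) ≠ 0 := by norm_num
    exact ⟨mul_ne_zero (pow_ne_zero _ ha0) (pow_ne_zero _ hn),
      mul_ne_zero (mul_ne_zero three (pow_ne_zero _ ha0)) (pow_ne_zero _ hn),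
      mul_ne_zero (mul_ne_zero three (pow_ne_zero _ ha0)) (pow_ne_zero _ hn),
      mul_ne_zero (mul_ne_zero two (pow_ne_zero _ ha0)) (pow_ne_zero _ hn),
      mul_ne_zero (pow_ne_zero _ ha0) (pow_ne_zero _ hn), weighted_power_identity ha _⟩
end
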